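/- Let (M_r)_{r ∈ ℤ} and (N_r)_{r ∈ ℤ} be families of finite-dimensional vector spaces over F₂, each equipped with linear maps v : M_{r+4} → M_r and v : N_{r+4} → N_r, and let f_r : M_r → N_r be linear maps commuting with v (i.e., f_r ∘ v = v ∘ f_{r+4} for all r). Suppose there exists R₀ ∈ ℤ such that f_r is an isomorphism for every r ≥ R₀. Setting ^∞M_r = ⋂_{l ≥ 0} image(v^l : M_{r+4l} → M_r) and ^∞N_r = ⋂_{l ≥ 0} image(v^l : N_{r+4l} → N_r), the map f_r carries ^∞M_r onto ^∞N_r for every r ∈ ℤ; in particular, if ^∞N_r ≠ 0 for some r, then ^∞M_r ≠ 0. -/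

import Mathlib

/-!
STATEMENT 8: Given two families `(M_r)`, `(N_r)` of finite-dimensional `F₂`-vector spaces
with structure maps `v` lowering the index by 4, and linear maps `f_r : M_r → N_r`
commuting with `v` that are isomorphisms in all degrees `r ≥ R₀`, the map `f_r` carries
the infinity part `^∞M_r` onto `^∞N_r` for every `r`; in particular, if `^∞N_r ≠ 0`
then `^∞M_r ≠ 0`.
-/

/-- The identity map of the family `N`, transported along an equality of indices. -/
def castHom (N : ℤ → Type) [∀ r, AddCommGroup (N r)] [∀ r, Module (ZMod 2) (N r)]
    {r s : ℤ} (h : r = s) : N r →ₗ[ZMod 2] N s := by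
  subst h; exact LinearMap.id

/-- The `l`-fold composite `v^l : N_{r+4l} → N_r` of the structure maps `v`. -/
def vpow (N : ℤ → Type) [∀ r, AddCommGroup (N r)] [∀ r, Module (ZMod 2) (N r)]
    (v : ∀ r : ℤ, N (r + 4) →ₗ[ZMod 2] N r) :
    (l : ℕ) → (r : ℤ) → (N (r + 4 * (l : ℤ)) →ₗ[ZMod 2] N r)
  | 0, r => castHom N (by simp)
  | (l + 1), r =>
      ((vpow N v l r).comp (v (r + 4 * (l : ℤ)))).comp
        (castHom N (by push_cast; ring))

/-- The infinity part `^∞N_r = ⋂_{l ≥ 0} image(v^l : N_{r+4l} → N_r)`. -/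
def infPart (N : ℤ → Type) [∀ r, AddCommGroup (N r)] [∀ r, Module (ZMod 2) (N r)]
    (v : ∀ r : ℤ, N (r + 4) →ₗ[ZMod 2] N r) (r : ℤ) : Submodule (ZMod 2) (N r) :=
  ⨅ l : ℕ, LinearMap.range (vpow N v l r)

theorem map_castHom {M N : ℤ → Type}
    [∀ r, AddCommGroup (M r)] [∀ r, Module (ZMod 2) (M r)]
    [∀ r, AddCommGroup (N r)] [∀ r, Module (ZMod 2) (N r)]
    (f : ∀ r : ℤ, M r →ₗ[ZMod 2] N r) {r s : ℤ} (h : r = s) (x : M r) :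
    f s (castHom M h x) = castHom N h (f r x) := by
  subst h; rfl

theorem map_vpow {M N : ℤ → Type}
    [∀ r, AddCommGroup (M r)] [∀ r, Module (ZMod 2) (M r)]
    [∀ r, AddCommGroup (N r)] [∀ r, Module (ZMod 2) (N r)]
    {vM : ∀ r : ℤ, M (r + 4) →ₗ[ZMod 2] M r}
    {vN : ∀ r : ℤ, N (r + 4) →ₗ[ZMod 2] N r}
    {f : ∀ r : ℤ, M r →ₗ[ZMod 2] N r}
    (hcomm : ∀ r : ℤ, (f r).comp (vM r) = (vN r).comp (f (r + 4)))
    (l : ℕ) (r : ℤ) (x : M (r + 4 * (l : ℤ))) :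
    f r (vpow M vM l r x) = vpow N vN l r (f _ x) := by
  induction l with
  | zero => exact map_castHom f _ x
  | succ l ih =>
    simp only [vpow, LinearMap.comp_apply]
    rw [ih, ← map_castHom f]
    exact congrArg _ (LinearMap.congr_fun (hcomm _) _)

theorem antitone_range_vpow (N : ℤ → Type)
    [∀ r, AddCommGroup (N r)] [∀ r, Module (ZMod 2) (N r)]
    (v : ∀ r : ℤ, N (r + 4) →ₗ[ZMod 2] N r) (r : ℤ) :
    Antitone fun l : ℕ => LinearMap.range (vpow N v l r) :=
  antitone_nat_of_succ_le fun l => by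
    simp only [vpow, LinearMap.comp_assoc]
    exact LinearMap.range_comp_le_range _ _

/-- In finite dimensions the infinity part is the image of every sufficiently high power. -/
theorem exists_infPart_eq_range_vpow (N : ℤ → Type)
    [∀ r, AddCommGroup (N r)] [∀ r, Module (ZMod 2) (N r)]
    [∀ r, FiniteDimensional (ZMod 2) (N r)]
    (v : ∀ r : ℤ, N (r + 4) →ₗ[ZMod 2] N r) (r : ℤ) :
    ∃ n : ℕ, ∀ l, n ≤ l → infPart N v r = LinearMap.range (vpow N v l r) := by
  have hanti := antitone_range_vpow N v r
  obtain ⟨n, hn⟩ := IsArtinian.monotone_stabilizes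
    (⟨fun l => OrderDual.toDual (LinearMap.range (vpow N v l r)), hanti⟩ :
      ℕ →o (Submodule (ZMod 2) (N r))ᵒᵈ)
  have hstable : ∀ m, n ≤ m →
      LinearMap.range (vpow N v n r) = LinearMap.range (vpow N v m r) := hn
  refine ⟨n, fun l hl => le_antisymm (iInf_le _ l) (le_iInf fun m => ?_)⟩
  rw [← hstable l hl, hstable (max n m) (le_max_left n m)]
  exact hanti (le_max_right n m)

theorem eventual_iso_carries_infPart_onto_infPart
    (M N : ℤ → Type)
    [∀ r, AddCommGroup (M r)] [∀ r, Module (ZMod 2) (M r)]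
    [∀ r, FiniteDimensional (ZMod 2) (M r)]
    [∀ r, AddCommGroup (N r)] [∀ r, Module (ZMod 2) (N r)]
    [∀ r, FiniteDimensional (ZMod 2) (N r)]
    (vM : ∀ r : ℤ, M (r + 4) →ₗ[ZMod 2] M r)
    (vN : ∀ r : ℤ, N (r + 4) →ₗ[ZMod 2] N r)
    (f : ∀ r : ℤ, M r →ₗ[ZMod 2] N r)
    (hcomm : ∀ r : ℤ, (f r).comp (vM r) = (vN r).comp (f (r + 4)))
    (hiso : ∃ R₀ : ℤ, ∀ r : ℤ, R₀ ≤ r → Function.Bijective (f r)) :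
    (∀ r : ℤ, Submodule.map (f r) (infPart M vM r) = infPart N vN r) ∧
    (∀ r : ℤ, infPart N vN r ≠ ⊥ → infPart M vM r ≠ ⊥) := by
  have hmap : ∀ r : ℤ, Submodule.map (f r) (infPart M vM r) = infPart N vN r := by
    intro r
    obtain ⟨R₀, hR⟩ := hiso
    obtain ⟨m, hm⟩ := exists_infPart_eq_range_vpow M vM r
    obtain ⟨n, hn⟩ := exists_infPart_eq_range_vpow N vN r
    obtain ⟨l, hml, hnl, hl⟩ : ∃ l : ℕ, m ≤ l ∧ n ≤ l ∧ R₀ ≤ r + 4 * (l : ℤ) :=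
      ⟨m + n + (R₀ - r).toNat, by omega, by omega, by omega⟩
    have hpow : (f r).comp (vpow M vM l r) = (vpow N vN l r).comp (f (r + 4 * (l : ℤ))) :=
      LinearMap.ext (map_vpow hcomm l r)
    rw [hm l hml, hn l hnl, ← LinearMap.range_comp, hpow,
      LinearMap.range_comp_of_range_eq_top _ (LinearMap.range_eq_top.2 (hR _ hl).2)]
  refine ⟨hmap, fun r hN hM => hN ?_⟩
  rw [← hmap r, hM, Submodule.map_bot]
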